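/- Let Λ be a cyclic Nakayama algebra and S a simple Λ-module of infinite projective dimension. Then Ω^{φdim Λ}(S) is a periodic module; more precisely, there exists a periodic module M with Ω^{φdim Λ}(S) ≅ Ω(M). -/

import Mathlib

open Function DirectSum
open scoped Classical

noncomputable section

section Preamble

variable (A : Type) [Ring A]

/-- A submodule is small (superfluous) if it has no proper supplement. -/
def IsSmallSubmodule {M : Type} [AddCommGroup M] [Module A M] (N : Submodule A M) : Prop :=
  ∀ K : Submodule A M, N ⊔ K = ⊤ → K = ⊤

/-- `P` is a projective cover of `M`: `P` is projective, finitely generated, and there is a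
surjection `P → M` with small (superfluous) kernel. -/
def IsProjCoverOf (P M : ModuleCat.{0} A) : Prop :=
  Module.Projective A ↥P ∧ Module.Finite A ↥P ∧
    ∃ f : ↥P →ₗ[A] ↥M, Function.Surjective f ∧ IsSmallSubmodule A (LinearMap.ker f)

/-- `N` is (isomorphic to) the syzygy `Ω(M)`, i.e. the kernel of a projective cover of `M`. -/
def IsSyzygyOf (N M : ModuleCat.{0} A) : Prop :=
  ∃ (P : ModuleCat.{0} A) (f : ↥P →ₗ[A] ↥M),
    Module.Projective A ↥P ∧ Module.Finite A ↥P ∧ Function.Surjective f ∧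
      IsSmallSubmodule A (LinearMap.ker f) ∧ Nonempty (↥N ≃ₗ[A] ↥(LinearMap.ker f))

/-- `N` is (isomorphic to) the `n`-th syzygy `Ω^n(M)`. -/
def IsNthSyzygyOf : ℕ → ModuleCat.{0} A → ModuleCat.{0} A → Prop
  | 0 => fun N M => Nonempty (↥N ≃ₗ[A] ↥M)
  | n + 1 => fun N M => ∃ K : ModuleCat.{0} A, IsNthSyzygyOf n K M ∧ IsSyzygyOf A N K

/-- An indecomposable module: nontrivial, with no nontrivial direct sum decomposition. -/
def IndecomposableModule (M : ModuleCat.{0} A) : Prop :=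
  Nontrivial ↥M ∧ ∀ N N' : Submodule A ↥M, IsCompl N N' → N = ⊥ ∨ N = ⊤

/-- A uniserial module: the submodules form a chain. -/
def IsUniserialModule (M : ModuleCat.{0} A) : Prop :=
  ∀ N N' : Submodule A ↥M, N ≤ N' ∨ N' ≤ N

/-- A (one-sided) Nakayama condition: an Artinian ring all of whose finitely generated
indecomposable modules are uniserial. -/
def IsNakayamaRing : Prop :=
  IsArtinianRing A ∧
    ∀ M : ModuleCat.{0} A, Module.Finite A ↥M → IndecomposableModule A M → IsUniserialModule A M

/-- A Nakayama algebra: all indecomposable finitely generated (left and right) modules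
are uniserial. -/
def IsNakayamaAlgebra : Prop := IsNakayamaRing A ∧ IsNakayamaRing Aᵐᵒᵖ

/-- Connectedness: the only central idempotents are `0` and `1`. -/
def IsConnectedRing : Prop :=
  ∀ e : A, IsIdempotentElem e → e ∈ Set.center A → e = 0 ∨ e = 1

/-- A cyclic Nakayama algebra: a connected Nakayama algebra whose quiver is a cyclically
oriented cycle, equivalently with no simple projective module. -/
def IsCyclicNakayama : Prop :=
  IsNakayamaAlgebra A ∧ IsConnectedRing A ∧
    ∀ M : ModuleCat.{0} A, IsSimpleModule A ↥M → ¬ Module.Projective A ↥M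

/-- The projective dimension of a module, computed via minimal projective resolutions:
the least `n` such that `Ω^n(M)` is projective (`⊤ = ∞` if there is none). -/
def projDim (M : ModuleCat.{0} A) : ℕ∞ :=
  sInf ((fun n : ℕ => (n : ℕ∞)) ''
    {n : ℕ | ∃ N : ModuleCat.{0} A, IsNthSyzygyOf A n N M ∧ Module.Projective A ↥N})

/-- The finitistic dimension: the supremum of the (finite) projective dimensions of
finitely generated modules of finite projective dimension. -/
def finDim : ℕ∞ :=
  sSup {d : ℕ∞ | d ≠ ⊤ ∧ ∃ M : ModuleCat.{0} A, Module.Finite A ↥M ∧ projDim A M = d}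

/-- The global dimension: the supremum of the projective dimensions of all finitely
generated modules. -/
def globalDim : ℕ∞ :=
  sSup {d : ℕ∞ | ∃ M : ModuleCat.{0} A, Module.Finite A ↥M ∧ projDim A M = d}

/-- `N` is a direct summand of `M`. -/
def IsDirectSummandOf (N M : ModuleCat.{0} A) : Prop :=
  ∃ C : ModuleCat.{0} A, Nonempty (↥M ≃ₗ[A] (↥N × ↥C))

/-- The delooping level of a module `M`:
`del M = min { d | Ω^d(M) is a direct summand of A ⊕ Ω^{d+1}(M') for some f.g. M' }`. -/
def delMod (M : ModuleCat.{0} A) : ℕ∞ :=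
  sInf ((fun n : ℕ => (n : ℕ∞)) ''
    {d : ℕ | ∃ (M' N N' : ModuleCat.{0} A), Module.Finite A ↥M' ∧
      IsNthSyzygyOf A d N M ∧ IsNthSyzygyOf A (d + 1) N' M' ∧
      IsDirectSummandOf A N (ModuleCat.of A (A × ↥N'))})

/-- The delooping level of the algebra: the supremum over simple modules. -/
def delAlg : ℕ∞ :=
  sSup {d : ℕ∞ | ∃ S : ModuleCat.{0} A, IsSimpleModule A ↥S ∧ delMod A S = d}

/-- A periodic module: `Ω^t(M) ≅ M` for some `t ≥ 1`. -/
def IsPeriodicModule (M : ModuleCat.{0} A) : Prop :=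
  ∃ t : ℕ, 1 ≤ t ∧ IsNthSyzygyOf A t M M

/-- Selfinjectivity: the regular module is injective. -/
def IsSelfinjectiveRing : Prop := Module.Injective A A

/-- The socle of a module: the sum of all simple submodules. -/
def socleOf (M : ModuleCat.{0} A) : Submodule A ↥M :=
  sSup {N : Submodule A ↥M | IsSimpleModule A ↥N}

/-- The radical of a module: `rad M = J(A)·M`. -/
def radOf (M : Type) [AddCommGroup M] [Module A M] : Submodule A M :=
  (Ideal.jacobson (⊥ : Ideal A)) • (⊤ : Submodule A M)

/-- The top of a module: `M / rad M`. -/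
abbrev topOf (M : Type) [AddCommGroup M] [Module A M] :=
  M ⧸ radOf A M

end Preamble

section Phi

variable (A : Type) [Ring A]

/-- Finitely generated indecomposable modules. -/
def FGIndec := {M : ModuleCat.{0} A // Module.Finite A ↥M ∧ IndecomposableModule A M}

/-- Isomorphism as a setoid on finitely generated indecomposable modules. -/
def indecSetoid : Setoid (FGIndec A) where
  r X Y := Nonempty (↥X.1 ≃ₗ[A] ↥Y.1)
  iseqv := ⟨fun _ => ⟨LinearEquiv.refl A _⟩,
            fun h => h.elim fun e => ⟨e.symm⟩,
            fun h h' => h.elim fun e => h'.elim fun e' => ⟨e.trans e'⟩⟩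

/-- Isomorphism classes of finitely generated indecomposable modules. -/
abbrev IndecIso := Quotient (indecSetoid A)

/-- The free abelian group on iso-classes of f.g. indecomposable modules. -/
abbrev K0Group := IndecIso A →₀ ℤ

/-- `f` records a decomposition of `M` as a direct sum of indecomposables with
multiplicities. -/
def IsDecompositionOf (f : IndecIso A →₀ ℕ) (M : ModuleCat.{0} A) : Prop :=
  Nonempty (↥M ≃ₗ[A] DirectSum (Σ x : f.support, Fin (f x.1))
    (fun i => ↥((Quotient.out i.1.1).1)))

/-- The class of `M` in the free abelian group on indecomposables (junk value `0` if no
decomposition exists). -/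
def decompClass (M : ModuleCat.{0} A) : K0Group A :=
  if h : ∃ f : IndecIso A →₀ ℕ, IsDecompositionOf A f M
  then (Classical.choose h).mapRange (fun m : ℕ => (m : ℤ)) (by simp)
  else 0

/-- A choice of syzygy module `Ω(M)` (junk value `0` if no projective cover exists). -/
def syzygyModule (M : ModuleCat.{0} A) : ModuleCat.{0} A :=
  if h : ∃ N : ModuleCat.{0} A, IsSyzygyOf A N M then Classical.choose h
  else ModuleCat.of A PUnit

/-- The Igusa–Todorov endomorphism `L` of the free abelian group on indecomposables,
sending `[M] ↦ [Ω M]`. -/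
def syzygyEnd : AddMonoid.End (K0Group A) :=
  Finsupp.liftAddHom fun x : IndecIso A =>
    (zmultiplesHom (K0Group A)) (decompClass A (syzygyModule A (Quotient.out x).1))

/-- The generators `[X]`, `X` an indecomposable direct summand of `M`, of the subgroup
`⟨add M⟩`. -/
def addGenerators (M : ModuleCat.{0} A) : Set (K0Group A) :=
  {g | ∃ (X : ModuleCat.{0} A) (h : Module.Finite A ↥X ∧ IndecomposableModule A X),
      IsDirectSummandOf A X M ∧ g = Finsupp.single (Quotient.mk (indecSetoid A) ⟨X, h⟩) 1}

/-- The Igusa–Todorov function `φ(M)`: the least `t` at which the rank of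
`L^t⟨add M⟩` stabilizes. -/
def phiMod (M : ModuleCat.{0} A) : ℕ∞ :=
  sInf ((fun n : ℕ => (n : ℕ∞)) ''
    {t : ℕ | ∀ j : ℕ, 1 ≤ j →
      Module.finrank ℤ
        ↥(AddSubgroup.map ((syzygyEnd A) ^ t) (AddSubgroup.closure (addGenerators A M))) =
      Module.finrank ℤ
        ↥(AddSubgroup.map ((syzygyEnd A) ^ (t + j)) (AddSubgroup.closure (addGenerators A M)))})

/-- The `φ`-dimension of the algebra. -/
def phiDim : ℕ∞ :=
  sSup {d : ℕ∞ | ∃ M : ModuleCat.{0} A, Module.Finite A ↥M ∧ phiMod A M = d}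

end Phi

section Epsilon

variable (A : Type) [Ring A]

/-- `T` is (isomorphic to) the socle of some indecomposable projective module. -/
def IsSocleOfIndecProjective (T : ModuleCat.{0} A) : Prop :=
  IsSimpleModule A ↥T ∧ ∃ Q : ModuleCat.{0} A, Module.Projective A ↥Q ∧ Module.Finite A ↥Q ∧
    IndecomposableModule A Q ∧ Nonempty (↥T ≃ₗ[A] ↥(socleOf A Q))

/-- `S` belongs to `S'(Λ)`: `S ≅ S_{i+1}` where `S_i` is a socle of an indecomposable
projective; here `S_{i+1} = top (rad P(S_i))` for the cyclic quiver. -/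
def IsInSPrime (S : ModuleCat.{0} A) : Prop :=
  IsSimpleModule A ↥S ∧ ∃ T P : ModuleCat.{0} A, IsSocleOfIndecProjective A T ∧
    IsProjCoverOf A P T ∧ Nonempty ((topOf A ↥(radOf A ↥P)) ≃ₗ[A] ↥S)

/-- `B` is (isomorphic to) the syzygy filtered algebra
`ε(Λ) = End_Λ(⊕_{S ∈ S'(Λ)} P(S))`. -/
def IsSyzygyFilteredAlgebra (B : Type) [Ring B] : Prop :=
  ∃ (ι : Type) (_ : Fintype ι) (Sf Pf : ι → ModuleCat.{0} A),
    (∀ i, IsInSPrime A (Sf i) ∧ IsProjCoverOf A (Pf i) (Sf i)) ∧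
    (∀ i j, Nonempty (↥(Sf i) ≃ₗ[A] ↥(Sf j)) → i = j) ∧
    (∀ S : ModuleCat.{0} A, IsInSPrime A S → ∃ i, Nonempty (↥S ≃ₗ[A] ↥(Sf i))) ∧
    Nonempty (B ≃+* Module.End A (DirectSum ι fun i => ↥(Pf i)))

/-- `B` is (isomorphic to) the `d`-th iterated syzygy filtered algebra `ε^d(Λ)`,
each intermediate step being a cyclic non-selfinjective Nakayama algebra. -/
def IsIterSyzygyFiltered (d : ℕ) (B : Type) [Ring B] : Prop :=
  ∃ C : ℕ → RingCat.{0},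
    Nonempty (A ≃+* ↥(C 0)) ∧ Nonempty (↥(C d) ≃+* B) ∧
    ∀ i < d, IsCyclicNakayama ↥(C i) ∧ ¬ IsSelfinjectiveRing ↥(C i) ∧
      IsSyzygyFilteredAlgebra ↥(C i) ↥(C (i + 1))

end Epsilon

section Syzygies

variable {A : Type} [Ring A]

theorem IsSmallSubmodule.ker_comp_of_equiv {P M M' : Type} [AddCommGroup P] [Module A P]
    [AddCommGroup M] [Module A M] [AddCommGroup M'] [Module A M'] {f : P →ₗ[A] M}
    (hf : IsSmallSubmodule A (LinearMap.ker f)) (e : M ≃ₗ[A] M') :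
    IsSmallSubmodule A (LinearMap.ker (e.toLinearMap ∘ₗ f)) := by
  rwa [LinearEquiv.ker_comp]

theorem IsSyzygyOf.congr_left {N N' M : ModuleCat.{0} A} (h : IsSyzygyOf A N M)
    (e : N' ≃ₗ[A] N) : IsSyzygyOf A N' M := by
  obtain ⟨P, f, hP, hPf, hf, hs, ⟨i⟩⟩ := h
  exact ⟨P, f, hP, hPf, hf, hs, ⟨e.trans i⟩⟩

theorem IsSyzygyOf.congr_right {N M M' : ModuleCat.{0} A} (h : IsSyzygyOf A N M)
    (e : M ≃ₗ[A] M') : IsSyzygyOf A N M' := by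
  obtain ⟨P, f, hP, hPf, hf, hs, ⟨i⟩⟩ := h
  exact ⟨P, e.toLinearMap ∘ₗ f, hP, hPf, e.surjective.comp hf, hs.ker_comp_of_equiv e,
    ⟨i.trans (LinearEquiv.ofEq _ _ (LinearEquiv.ker_comp _ _).symm)⟩⟩

/-- Projective covers are unique up to isomorphism over the covered module. -/
theorem exists_equiv_of_projective_covers {P Q M : Type} [AddCommGroup P] [Module A P]
    [AddCommGroup Q] [Module A Q] [AddCommGroup M] [Module A M]
    [Module.Projective A P] [Module.Projective A Q] {f : P →ₗ[A] M} {g : Q →ₗ[A] M}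
    (hf : Function.Surjective f) (hg : Function.Surjective g)
    (hfs : IsSmallSubmodule A (LinearMap.ker f)) (hgs : IsSmallSubmodule A (LinearMap.ker g)) :
    ∃ e : P ≃ₗ[A] Q, g ∘ₗ e.toLinearMap = f := by
  obtain ⟨h, hh⟩ := Module.projective_lifting_property g f hg
  have hh' : ∀ x, g (h x) = f x := fun x => LinearMap.congr_fun hh x
  have hsurj : Function.Surjective h := by
    rw [← LinearMap.range_eq_top]
    refine hgs _ (eq_top_iff.mpr fun q _ => ?_)
    obtain ⟨p, hp⟩ := hf (g q)
    rw [← sub_add_cancel q (h p)]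
    exact Submodule.add_mem_sup (by simp [hh', hp]) ⟨p, rfl⟩
  obtain ⟨s, hs⟩ := Module.projective_lifting_property h LinearMap.id hsurj
  have hs' : ∀ x, h (s x) = x := fun x => LinearMap.congr_fun hs x
  have hrange : LinearMap.range s = ⊤ := by
    refine hfs _ (eq_top_iff.mpr fun p _ => ?_)
    rw [← sub_add_cancel p (s (h p))]
    refine Submodule.add_mem_sup ?_ ⟨h p, rfl⟩
    rw [LinearMap.mem_ker, map_sub, ← hh', ← hh', hs', sub_self]
  have hinj : Function.Injective h := by
    intro x y hxy
    obtain ⟨x, rfl⟩ := LinearMap.range_eq_top.mp hrange x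
    obtain ⟨y, rfl⟩ := LinearMap.range_eq_top.mp hrange y
    rw [hs', hs'] at hxy
    rw [hxy]
  exact ⟨LinearEquiv.ofBijective h ⟨hinj, hsurj⟩, hh⟩

theorem IsSyzygyOf.unique {N N' M : ModuleCat.{0} A} (h : IsSyzygyOf A N M)
    (h' : IsSyzygyOf A N' M) : Nonempty (N ≃ₗ[A] N') := by
  obtain ⟨P, f, hP, -, hf, hs, ⟨i⟩⟩ := h
  obtain ⟨P', f', hP', -, hf', hs', ⟨i'⟩⟩ := h'
  obtain ⟨e, he⟩ := exists_equiv_of_projective_covers hf hf' hs hs'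
  have hmap : (LinearMap.ker f).map e.toLinearMap = LinearMap.ker f' := by
    subst he
    rw [LinearMap.ker_comp, Submodule.map_comap_eq_of_surjective e.surjective]
  exact ⟨i.trans ((e.submoduleMap _).trans ((LinearEquiv.ofEq _ _ hmap).trans i'.symm))⟩

theorem IsNthSyzygyOf.congr_left {n : ℕ} {N N' M : ModuleCat.{0} A}
    (h : IsNthSyzygyOf A n N M) (e : N' ≃ₗ[A] N) : IsNthSyzygyOf A n N' M := by
  cases n with
  | zero => exact h.map e.trans
  | succ n =>
    obtain ⟨K, hK, hN⟩ := h
    exact ⟨K, hK, hN.congr_left e⟩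

theorem IsNthSyzygyOf.congr_right {n : ℕ} {N M M' : ModuleCat.{0} A}
    (h : IsNthSyzygyOf A n N M) (e : M ≃ₗ[A] M') : IsNthSyzygyOf A n N M' := by
  induction n generalizing N with
  | zero => exact h.map fun i => i.trans e
  | succ n ih =>
    obtain ⟨K, hK, hN⟩ := h
    exact ⟨K, ih hK, hN⟩

theorem IsNthSyzygyOf.unique {n : ℕ} {N N' M : ModuleCat.{0} A}
    (h : IsNthSyzygyOf A n N M) (h' : IsNthSyzygyOf A n N' M) : Nonempty (N ≃ₗ[A] N') := by
  induction n generalizing N N' with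
  | zero =>
    obtain ⟨e⟩ := h
    obtain ⟨e'⟩ := h'
    exact ⟨e.trans e'.symm⟩
  | succ n ih =>
    obtain ⟨K, hK, hN⟩ := h
    obtain ⟨K', hK', hN'⟩ := h'
    obtain ⟨e⟩ := ih hK hK'
    exact (hN.congr_right e).unique hN'

theorem IsNthSyzygyOf.trans {a b : ℕ} {N K M : ModuleCat.{0} A}
    (h : IsNthSyzygyOf A b N K) (h' : IsNthSyzygyOf A a K M) : IsNthSyzygyOf A (a + b) N M := by
  induction b generalizing N with
  | zero =>
    obtain ⟨e⟩ := h
    exact h'.congr_left e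
  | succ b ih =>
    obtain ⟨L, hL, hN⟩ := h
    exact ⟨L, ih hL, hN⟩

theorem IsNthSyzygyOf.exists_intermediate {a b : ℕ} {N M : ModuleCat.{0} A}
    (h : IsNthSyzygyOf A (a + b) N M) :
    ∃ K : ModuleCat.{0} A, IsNthSyzygyOf A a K M ∧ IsNthSyzygyOf A b N K := by
  induction b generalizing N with
  | zero => exact ⟨N, h, ⟨LinearEquiv.refl A N⟩⟩
  | succ b ih =>
    obtain ⟨L, hL, hN⟩ := h
    obtain ⟨K, hK, hLK⟩ := ih hL
    exact ⟨K, hK, L, hLK, hN⟩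

theorem IsSyzygyOf.isNthSyzygyOf_one {N M : ModuleCat.{0} A} (h : IsSyzygyOf A N M) :
    IsNthSyzygyOf A 1 N M :=
  ⟨M, ⟨LinearEquiv.refl A M⟩, h⟩

theorem isSyzygyOf_syzygyModule {N M : ModuleCat.{0} A} (h : IsSyzygyOf A N M) :
    IsSyzygyOf A (syzygyModule A M) M := by
  have hex : ∃ N : ModuleCat.{0} A, IsSyzygyOf A N M := ⟨N, h⟩
  rw [syzygyModule, dif_pos hex]
  exact Classical.choose_spec hex

end Syzygies

section Uniserial

variable {A : Type} [Ring A]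

theorem IsUniserialModule.submodule_le_total {M : ModuleCat.{0} A} (hM : IsUniserialModule A M)
    {N : Type*} [AddCommGroup N] [Module A N] (f : N →ₗ[A] M) (hf : Function.Injective f)
    (K K' : Submodule A N) : K ≤ K' ∨ K' ≤ K := by
  rw [← Submodule.map_le_map_iff_of_injective hf K K',
    ← Submodule.map_le_map_iff_of_injective hf K' K]
  exact hM _ _

theorem IsUniserialModule.indecomposable {M : ModuleCat.{0} A} (hM : IsUniserialModule A M)
    [Nontrivial M] : IndecomposableModule A M :=
  ⟨‹_›, fun N N' h => (hM N N').imp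
    (fun hle => le_bot_iff.mp (h.disjoint le_rfl hle))
    (fun hle => top_le_iff.mp (h.codisjoint le_rfl hle))⟩

theorem IsUniserialModule.isSmallSubmodule {M : ModuleCat.{0} A} (hM : IsUniserialModule A M)
    {N : Submodule A M} (hN : N ≠ ⊤) : IsSmallSubmodule A N := fun K hK => by
  rcases hM N K with h | h
  · rwa [sup_eq_right.mpr h] at hK
  · exact absurd (sup_eq_left.mpr h ▸ hK) hN

theorem IsUniserialModule.finite_submodule {M : ModuleCat.{0} A} (hM : IsUniserialModule A M)
    [IsArtinian A M] [IsNoetherian A M] : Finite (Submodule A M) := by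
  have : Std.Total (α := Submodule A M) (· ≤ ·) := ⟨hM⟩
  let : LinearOrder (Submodule A M) := Lattice.toLinearOrder _
  have : WellFoundedLT (Submodule A M) := ‹IsArtinian A M›
  have : WellFoundedGT (Submodule A M) := (isNoetherian_iff'.mp ‹_›)
  exact Finite.of_wellFoundedLT_wellFoundedGT _

/-- A projective submodule of an Artinian Nakayama ring is a finite sum of uniserial projective
submodules. -/
theorem IsNakayamaRing.exists_uniserial_projectives (hA : IsNakayamaRing A)
    (N : Submodule A A) (hN : Module.Projective A N) :
    ∃ s : Finset (Submodule A A), s.sup id = N ∧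
      ∀ P ∈ s, Module.Projective A P ∧ IsUniserialModule A (ModuleCat.of A P) := by
  have := hA.1
  induction N using WellFoundedLT.induction with
  | ind N ih =>
  by_cases hind : IndecomposableModule A (ModuleCat.of A N)
  · refine ⟨{N}, by simp, fun P hP => ?_⟩
    obtain rfl := Finset.mem_singleton.mp hP
    exact ⟨hN, hA.2 _ (inferInstanceAs (Module.Finite A P)) hind⟩
  rcases subsingleton_or_nontrivial N with hsub | hnt
  · refine ⟨∅, ?_, by simp⟩
    rw [(Submodule.subsingleton_iff_eq_bot).mp hsub, Finset.sup_empty]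
  have hdec : ∃ K K' : Submodule A N, IsCompl K K' ∧ K ≠ ⊥ ∧ K ≠ ⊤ := by
    by_contra! hcon
    exact hind ⟨hnt, fun K K' h => or_iff_not_imp_left.mpr (hcon K K' h)⟩
  obtain ⟨K, K', hc, hbot, htop⟩ := hdec
  have key : ∀ {L L' : Submodule A N}, IsCompl L L' → L ≠ ⊤ →
      ∃ s : Finset (Submodule A A), s.sup id = L.map N.subtype ∧
        ∀ P ∈ s, Module.Projective A P ∧ IsUniserialModule A (ModuleCat.of A P) := by
    intro L L' hL hLt
    refine ih _ ?_ ?_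
    · refine lt_of_le_of_ne (Submodule.map_subtype_le N L) fun h => hLt ?_
      refine Submodule.map_injective_of_injective N.subtype_injective ?_
      rw [h, Submodule.map_subtype_top]
    · have : Module.Projective A L :=
        Module.Projective.of_split L.subtype (L.projectionOnto L' hL)
          (Submodule.projectionOnto_comp_subtype hL)
      exact Module.Projective.of_equiv
        (Submodule.equivMapOfInjective N.subtype N.subtype_injective L)
  have htop' : K' ≠ ⊤ := by
    rintro rfl
    exact hbot (by simpa using hc.disjoint)
  obtain ⟨s, hs, hs'⟩ := key hc htop
  obtain ⟨u, hu, hu'⟩ := key hc.symm htop'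
  refine ⟨s ∪ u, ?_, fun P hP => (Finset.mem_union.mp hP).elim (hs' P) (hu' P)⟩
  rw [Finset.sup_union, hs, hu, ← Submodule.map_sup, hc.sup_eq_top, Submodule.map_subtype_top]

/-- A finitely generated uniserial module is an image of one of the submodules summing up
to the regular module. -/
theorem IsUniserialModule.exists_surjective {M : ModuleCat.{0} A} (hM : IsUniserialModule A M)
    [Nontrivial M] [Module.Finite A M] (s : Finset (Submodule A A)) (hs : s.sup id = ⊤) :
    ∃ P ∈ s, ∃ f : P →ₗ[A] M, Function.Surjective f := by
  obtain ⟨R, hR⟩ := IsCoatomic.exists_coatom (Submodule A M)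
  obtain ⟨m, hm⟩ : ∃ m : M, m ∉ R := by
    by_contra! h
    exact hR.1 (eq_top_iff.mpr fun x _ => h x)
  let g : A →ₗ[A] M := LinearMap.toSpanSingleton A M m
  obtain ⟨P, hP, hPR⟩ : ∃ P ∈ s, ¬ P ≤ R.comap g := by
    by_contra! h
    have h1 : (1 : A) ∈ R.comap g := (Finset.sup_le h : s.sup id ≤ _) (hs ▸ Submodule.mem_top)
    exact hm (by simpa [g] using h1)
  refine ⟨P, hP, g ∘ₗ P.subtype, ?_⟩
  have hrange : LinearMap.range (g ∘ₗ P.subtype) = P.map g := by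
    rw [LinearMap.range_comp, Submodule.range_subtype]
  rw [← LinearMap.range_eq_top, hrange]
  rw [← Submodule.map_le_iff_le_comap] at hPR
  exact hR.2 _ (lt_of_le_not_ge ((hM _ _).resolve_left hPR) hPR)

end Uniserial


section Decomposition

variable {A : Type} [Ring A]

theorem directSum_lof_surjective_of_subsingleton {ι : Type*} [Subsingleton ι]
    (Z : ι → Type) [∀ i, AddCommGroup (Z i)] [∀ i, Module A (Z i)] (i : ι) :
    Function.Surjective (DirectSum.lof A ι Z i) := by
  rw [← LinearMap.range_eq_top, eq_top_iff]
  rintro x -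
  induction x using DirectSum.induction_on with
  | zero => exact Submodule.zero_mem _
  | of j z =>
    obtain rfl := Subsingleton.elim i j
    exact ⟨z, rfl⟩
  | add x y hx hy => exact Submodule.add_mem _ hx hy

/-- The summand inclusion for a direct sum over a one-point type, as an isomorphism. -/
def directSumLofEquiv {ι : Type*} [Subsingleton ι]
    (Z : ι → Type) [∀ i, AddCommGroup (Z i)] [∀ i, Module A (Z i)] (i : ι) :
    Z i ≃ₗ[A] DirectSum ι Z :=
  LinearEquiv.ofBijective (DirectSum.lof A ι Z i)
    ⟨DirectSum.of_injective i, directSum_lof_surjective_of_subsingleton Z i⟩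

theorem subsingleton_index_of_uniserial {ι : Type*} (Z : ι → Type)
    [∀ i, AddCommGroup (Z i)] [∀ i, Module A (Z i)] [∀ i, Nontrivial (Z i)]
    (h : ∀ N N' : Submodule A (DirectSum ι Z), N ≤ N' ∨ N' ≤ N) : Subsingleton ι := by
  have key : ∀ i j : ι, LinearMap.range (DirectSum.lof A ι Z i) ≤
      LinearMap.range (DirectSum.lof A ι Z j) → i = j := by
    intro i j hle
    by_contra hij
    obtain ⟨x, hx⟩ := exists_ne (0 : Z i)
    obtain ⟨y, hy⟩ := hle ⟨x, rfl⟩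
    have hi := congrArg (fun d => d i) hy
    rw [DirectSum.lof_eq_of, DirectSum.lof_eq_of, DirectSum.of_eq_same,
      DirectSum.of_eq_of_ne _ _ _ hij] at hi
    exact hx hi.symm
  exact ⟨fun i j => (h _ _).elim (key i j) fun hji => (key j i hji).symm⟩

theorem nonempty_equiv_out (X : FGIndec A) :
    Nonempty ((Quotient.out (Quotient.mk (indecSetoid A) X)).1 ≃ₗ[A] X.1) :=
  Quotient.exact (s := indecSetoid A) (Quotient.out_eq _)

theorem isDecompositionOf_single {W : ModuleCat.{0} A} (X : FGIndec A) (e : W ≃ₗ[A] X.1) :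
    IsDecompositionOf A (Finsupp.single (Quotient.mk (indecSetoid A) X) 1) W := by
  set c : IndecIso A := Quotient.mk (indecSetoid A) X
  set f : IndecIso A →₀ ℕ := Finsupp.single c 1 with hf
  have hmem : c ∈ f.support := by simp [hf]
  have hval : f c = 1 := by simp [hf]
  have hsub : Subsingleton (Σ x : f.support, Fin (f x.1)) := by
    have heq : ∀ x : f.support, x = ⟨c, hmem⟩ := by
      rintro ⟨x, hx⟩
      have hx' : x = c := by
        by_contra hne
        exact Finsupp.mem_support_iff.mp hx (Finsupp.single_eq_of_ne hne)
      subst hx'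
      rfl
    refine ⟨?_⟩
    rintro ⟨x, i⟩ ⟨y, j⟩
    obtain rfl := heq x
    obtain rfl := heq y
    have : Subsingleton (Fin (f c)) := by rw [hval]; infer_instance
    rw [Subsingleton.elim i j]
  obtain ⟨i⟩ := nonempty_equiv_out X
  exact ⟨e.trans (i.symm.trans (directSumLofEquiv
    (fun i : Σ x : f.support, Fin (f x.1) => ↥((Quotient.out i.1.1).1))
    ⟨⟨c, hmem⟩, ⟨0, by rw [hval]; exact one_pos⟩⟩))⟩

theorem IsDecompositionOf.eq_single {f : IndecIso A →₀ ℕ} {W : ModuleCat.{0} A}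
    (h : IsDecompositionOf A f W) (X : FGIndec A) (hX : IsUniserialModule A X.1)
    (e : W ≃ₗ[A] X.1) : f = Finsupp.single (Quotient.mk (indecSetoid A) X) 1 := by
  obtain ⟨d⟩ := h
  let Z : (Σ x : f.support, Fin (f x.1)) → Type := fun i => ↥((Quotient.out i.1.1).1)
  have hnt : ∀ i, Nontrivial (Z i) := fun i => (Quotient.out i.1.1).2.2.1
  have hsub : Subsingleton (Σ x : f.support, Fin (f x.1)) :=
    subsingleton_index_of_uniserial (A := A) Z
      (hX.submodule_le_total (d.symm.trans e).toLinearMap (d.symm.trans e).injective)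
  have hne : Nonempty (Σ x : f.support, Fin (f x.1)) := by
    by_contra hemp
    rw [not_nonempty_iff] at hemp
    have hXnt : Nontrivial X.1 := X.2.2.1
    have hD : Subsingleton (DirectSum _ Z) := ⟨fun x y => DFinsupp.ext fun i => hemp.elim i⟩
    have := (e.symm.trans d).toEquiv.subsingleton
    exact not_subsingleton X.1 this
  obtain ⟨⟨⟨c, hc⟩, i⟩⟩ := hne
  have hcX : c = Quotient.mk (indecSetoid A) X := by
    rw [← Quotient.out_eq c]
    exact Quotient.sound (s := indecSetoid A)
      ⟨(directSumLofEquiv Z ⟨⟨c, hc⟩, i⟩).trans (d.symm.trans e)⟩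
  subst hcX
  ext y
  by_cases hy : y = Quotient.mk (indecSetoid A) X
  · subst hy
    have hFin : Subsingleton (Fin (f (Quotient.mk (indecSetoid A) X))) := ⟨fun j k => by
      have hjk := hsub.elim ⟨⟨_, hc⟩, j⟩ ⟨⟨_, hc⟩, k⟩
      simpa using hjk⟩
    rw [Finsupp.single_eq_same]
    exact le_antisymm (Fin.subsingleton_iff_le_one.mp hFin) i.pos
  · rw [Finsupp.single_eq_of_ne hy]
    by_contra hfy
    have hyi := hsub.elim ⟨⟨y, Finsupp.mem_support_iff.mpr hfy⟩, ⟨0, Nat.pos_of_ne_zero hfy⟩⟩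
      ⟨⟨_, hc⟩, i⟩
    exact hy (congrArg (fun z => z.1.1) hyi)

theorem decompClass_eq_single {W : ModuleCat.{0} A} (X : FGIndec A)
    (hX : IsUniserialModule A X.1) (e : W ≃ₗ[A] X.1) :
    decompClass A W = Finsupp.single (Quotient.mk (indecSetoid A) X) 1 := by
  have hex : ∃ f : IndecIso A →₀ ℕ, IsDecompositionOf A f W := ⟨_, isDecompositionOf_single X e⟩
  rw [decompClass, dif_pos hex, (Classical.choose_spec hex).eq_single X hX e,
    Finsupp.mapRange_single, Nat.cast_one]

theorem syzygyEnd_single {X Y : FGIndec A} (hY : IsUniserialModule A Y.1)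
    (h : IsSyzygyOf A Y.1 X.1) :
    syzygyEnd A (Finsupp.single (Quotient.mk (indecSetoid A) X) 1) =
      Finsupp.single (Quotient.mk (indecSetoid A) Y) 1 := by
  obtain ⟨i⟩ := nonempty_equiv_out X
  obtain ⟨e⟩ := (isSyzygyOf_syzygyModule (h.congr_right i.symm)).unique (h.congr_right i.symm)
  have hL : syzygyEnd A (Finsupp.single (Quotient.mk (indecSetoid A) X) 1) =
      (1 : ℤ) • decompClass A
        (syzygyModule A (Quotient.out (Quotient.mk (indecSetoid A) X)).1) :=
    Finsupp.liftAddHom_apply_single _ _ _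
  rw [hL, one_zsmul]
  exact decompClass_eq_single Y hY e

theorem syzygyEnd_pow_add_apply (m n : ℕ) (x : K0Group A) :
    ((syzygyEnd A) ^ (m + n)) x = ((syzygyEnd A) ^ m) (((syzygyEnd A) ^ n) x) := by
  rw [pow_add]
  rfl

end Decomposition

section Finiteness

variable {A : Type} [Ring A]

theorem IsNakayamaRing.finite_indecIso (hA : IsNakayamaRing A) : Finite (IndecIso A) := by
  have := hA.1
  obtain ⟨s, hs, hs'⟩ := hA.exists_uniserial_projectives ⊤
    (Module.Projective.of_equiv (Submodule.topEquiv (R := A) (M := A)).symm)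
  have hfin : ∀ P : s, Finite (Submodule A P.1) := fun P =>
    (hs' P.1 P.2).2.finite_submodule
  have hex : ∀ x : IndecIso A, ∃ z : Σ P : s, Submodule A P.1,
      Nonempty ((z.1.1 ⧸ z.2) ≃ₗ[A] (Quotient.out x).1) := by
    intro x
    obtain ⟨hf, hi⟩ := (Quotient.out x).2
    have := hi.1
    obtain ⟨P, hP, f, hfs⟩ := (hA.2 _ hf hi).exists_surjective s hs
    exact ⟨⟨⟨P, hP⟩, LinearMap.ker f⟩, ⟨f.quotKerEquivOfSurjective hfs⟩⟩
  choose z hz using hex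
  refine Finite.of_injective z fun x y hxy => ?_
  obtain ⟨e⟩ := hz x
  obtain ⟨e'⟩ := hz y
  rw [← Quotient.out_eq x, ← Quotient.out_eq y]
  rw [hxy] at e
  exact Quotient.sound (s := indecSetoid A) ⟨e.symm.trans e'⟩

/-- A finitely generated uniserial module over a Nakayama ring has a uniserial, finitely
generated syzygy. -/
theorem IsNakayamaRing.exists_uniserial_syzygy (hA : IsNakayamaRing A) {M : ModuleCat.{0} A}
    (hM : IsUniserialModule A M) [Nontrivial M] [Module.Finite A M] :
    ∃ N : ModuleCat.{0} A, IsSyzygyOf A N M ∧ Module.Finite A N ∧ IsUniserialModule A N := by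
  have := hA.1
  obtain ⟨s, hs, hs'⟩ := hA.exists_uniserial_projectives ⊤
    (Module.Projective.of_equiv (Submodule.topEquiv (R := A) (M := A)).symm)
  obtain ⟨P, hP, f, hf⟩ := hM.exists_surjective s hs
  obtain ⟨hproj, huni⟩ := hs' P hP
  have hker : LinearMap.ker f ≠ ⊤ := by
    intro h
    obtain ⟨m, hm⟩ := exists_ne (0 : M)
    obtain ⟨p, rfl⟩ := hf m
    exact hm (LinearMap.mem_ker.mp (h ▸ Submodule.mem_top))
  exact ⟨ModuleCat.of A (LinearMap.ker f),
    ⟨ModuleCat.of A P, f, hproj, inferInstanceAs (Module.Finite A P), hf,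
      huni.isSmallSubmodule hker, ⟨LinearEquiv.refl A _⟩⟩,
    inferInstanceAs (Module.Finite A (LinearMap.ker f)),
    huni.submodule_le_total (LinearMap.ker f).subtype (LinearMap.ker f).subtype_injective⟩

theorem isDirectSummandOf_of_leftInverse {X M : ModuleCat.{0} A} (f : X →ₗ[A] M) (r : M →ₗ[A] X)
    (h : Function.LeftInverse r f) : IsDirectSummandOf A X M := by
  have hc := LinearMap.isCompl_of_proj (p := LinearMap.range f) (f := f.rangeRestrict ∘ₗ r) <| by
    rintro ⟨_, x, rfl⟩
    exact Subtype.ext (congrArg f (h x))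
  exact ⟨ModuleCat.of A (LinearMap.ker (f.rangeRestrict ∘ₗ r)),
    ⟨(Submodule.prodEquivOfIsCompl _ _ hc).symm.trans
      (LinearEquiv.prodCongr (LinearEquiv.ofInjective f h.injective).symm (LinearEquiv.refl A _))⟩⟩

/-- If all indecomposables lie in finitely many isomorphism classes, some finitely generated
module has each of them as a direct summand. -/
theorem exists_finite_addGenerators_closure_eq_top [Finite (IndecIso A)] :
    ∃ M : ModuleCat.{0} A, Module.Finite A M ∧
      AddSubgroup.closure (addGenerators A M) = ⊤ := by
  obtain ⟨n, ⟨σ⟩⟩ := Finite.exists_equiv_fin (IndecIso A)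
  let Z : Fin n → Type := fun i => ↥((Quotient.out (σ.symm i)).1)
  have hZ : ∀ i, Module.Finite A (Z i) := fun i => (Quotient.out (σ.symm i)).2.1
  refine ⟨ModuleCat.of A (∀ i, Z i), inferInstanceAs (Module.Finite A (∀ i, Z i)), ?_⟩
  have hgen : ∀ x : IndecIso A,
      Finsupp.single x (1 : ℤ) ∈ addGenerators A (ModuleCat.of A (∀ i, Z i)) := by
    intro x
    obtain ⟨i, rfl⟩ := σ.symm.surjective x
    refine ⟨(Quotient.out (σ.symm i)).1, (Quotient.out (σ.symm i)).2,
      isDirectSummandOf_of_leftInverse (M := ModuleCat.of A (∀ i, Z i))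
        (LinearMap.single A Z i) (LinearMap.proj i) fun z => Pi.single_eq_same (M := Z) i z, ?_⟩
    exact congrArg (fun y => Finsupp.single y (1 : ℤ)) (Quotient.out_eq (σ.symm i)).symm
  refine (AddSubgroup.eq_top_iff' _).mpr fun g => ?_
  induction g using Finsupp.induction_linear with
  | zero => exact AddSubgroup.zero_mem _
  | add f g hf hg => exact AddSubgroup.add_mem _ hf hg
  | single x m =>
    have hm := AddSubgroup.zsmul_mem _ (AddSubgroup.subset_closure (hgen x)) m
    rwa [Finsupp.smul_single, smul_eq_mul, mul_one] at hm

end Finiteness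

section Stabilization

theorem eq_of_finrank_map_eq {G : Type*} [AddCommGroup G] [Module.Free ℤ G] [Module.Finite ℤ G]
    (L : AddMonoid.End G) (H : AddSubgroup G)
    (hr : Module.finrank ℤ H = Module.finrank ℤ (AddSubgroup.map L H)) {x y : G}
    (hx : x ∈ H) (hy : y ∈ H) (hxy : L x = L y) : x = y := by
  let H' : Submodule ℤ G := AddSubgroup.toIntSubmodule H
  let g : H' →ₗ[ℤ] G := (AddMonoidHom.toIntLinearMap L) ∘ₗ H'.subtype
  have hrange : LinearMap.range g = AddSubgroup.toIntSubmodule (AddSubgroup.map L H) := by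
    rw [LinearMap.range_comp, Submodule.range_subtype]
    rfl
  have hrank : Module.finrank ℤ (LinearMap.range g) = Module.finrank ℤ H' := by
    rw [hrange]
    exact hr.symm
  have hadd := (LinearMap.ker g).finrank_quotient_add_finrank
  rw [g.quotKerEquivRange.finrank_eq] at hadd
  have hzero : Module.finrank ℤ (LinearMap.ker g) = 0 := by omega
  have hker : LinearMap.ker g = ⊥ := by
    rw [Module.finrank_eq_zero_iff_of_free] at hzero
    exact Submodule.subsingleton_iff_eq_bot.mp hzero
  exact congrArg Subtype.val
    (LinearMap.ker_eq_bot.mp hker (a₁ := ⟨x, hx⟩) (a₂ := ⟨y, hy⟩) hxy)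

variable {A : Type} [Ring A]

theorem finrank_map_syzygyEnd_pow_eq {t : ℕ} (ht : phiDim A = (t : ℕ∞)) {M : ModuleCat.{0} A}
    (hM : Module.Finite A M) (j : ℕ) :
    Module.finrank ℤ
        ↥(AddSubgroup.map ((syzygyEnd A) ^ t) (AddSubgroup.closure (addGenerators A M))) =
      Module.finrank ℤ
        ↥(AddSubgroup.map ((syzygyEnd A) ^ (t + j))
          (AddSubgroup.closure (addGenerators A M))) := by
  have hle : phiMod A M ≤ t := ht ▸ le_sSup ⟨M, hM, rfl⟩
  have hmem := csInf_mem (s := (fun n : ℕ => (n : ℕ∞)) ''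
    {t : ℕ | ∀ j : ℕ, 1 ≤ j →
      Module.finrank ℤ
        ↥(AddSubgroup.map ((syzygyEnd A) ^ t) (AddSubgroup.closure (addGenerators A M))) =
      Module.finrank ℤ
        ↥(AddSubgroup.map ((syzygyEnd A) ^ (t + j))
          (AddSubgroup.closure (addGenerators A M)))}) <| by
    rw [Set.nonempty_iff_ne_empty]
    intro hemp
    rw [phiMod, hemp, sInf_empty] at hle
    exact ENat.natCast_ne_top t (top_le_iff.mp hle)
  obtain ⟨u, hu, hu'⟩ := hmem
  have hut : u ≤ t := by
    have : ((u : ℕ) : ℕ∞) ≤ t := hu'.trans_le hle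
    exact_mod_cast this
  have hstab : ∀ k : ℕ, Module.finrank ℤ
        ↥(AddSubgroup.map ((syzygyEnd A) ^ u) (AddSubgroup.closure (addGenerators A M))) =
      Module.finrank ℤ
        ↥(AddSubgroup.map ((syzygyEnd A) ^ (u + k))
          (AddSubgroup.closure (addGenerators A M))) := by
    intro k
    rcases Nat.eq_zero_or_pos k with rfl | hk
    · rfl
    · exact hu k hk
  obtain ⟨k, rfl⟩ := Nat.exists_eq_add_of_le hut
  rw [← hstab k, add_assoc, ← hstab (k + j)]

/-- Past the `φ`-dimension, powers of the syzygy operator are injective. -/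
theorem syzygyEnd_pow_injective {t : ℕ} (ht : phiDim A = (t : ℕ∞)) [Finite (IndecIso A)] (j : ℕ)
    {x y : K0Group A}
    (hxy : ((syzygyEnd A) ^ (t + j)) x = ((syzygyEnd A) ^ (t + j)) y) :
    ((syzygyEnd A) ^ t) x = ((syzygyEnd A) ^ t) y := by
  obtain ⟨M, hM, htop⟩ := exists_finite_addGenerators_closure_eq_top (A := A)
  have hr := finrank_map_syzygyEnd_pow_eq ht hM j
  rw [htop] at hr
  have hmap : AddSubgroup.map ((syzygyEnd A) ^ (t + j)) ⊤ =
      AddSubgroup.map ((syzygyEnd A) ^ j) (AddSubgroup.map ((syzygyEnd A) ^ t) ⊤) := by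
    rw [add_comm, pow_add]
    exact (AddSubgroup.map_map ⊤ ((syzygyEnd A) ^ j) ((syzygyEnd A) ^ t)).symm
  rw [hmap] at hr
  refine eq_of_finrank_map_eq ((syzygyEnd A) ^ j) _ hr ⟨x, trivial, rfl⟩ ⟨y, trivial, rfl⟩ ?_
  rwa [← syzygyEnd_pow_add_apply, ← syzygyEnd_pow_add_apply, add_comm]

end Stabilization

section InfiniteProjectiveDimension

variable {A : Type} [Ring A]

theorem nontrivial_of_isNthSyzygyOf {M N : ModuleCat.{0} A} (hpd : projDim A M = ⊤) {n : ℕ}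
    (hN : IsNthSyzygyOf A n N M) : Nontrivial N := by
  by_contra h
  rw [not_nontrivial_iff_subsingleton] at h
  have hle : projDim A M ≤ n := sInf_le ⟨n, ⟨N, hN, Module.Projective.of_free⟩, rfl⟩
  exact ENat.natCast_ne_top n (top_le_iff.mp (hpd ▸ hle))

/-- The syzygies of an indecomposable module of infinite projective dimension over a Nakayama
ring are indecomposable, and their classes are computed by the syzygy operator. -/
theorem IsNakayamaRing.exists_indecomposable_nthSyzygy (hA : IsNakayamaRing A) (X : FGIndec A)
    (hpd : projDim A X.1 = ⊤) (n : ℕ) :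
    ∃ Y : FGIndec A, IsNthSyzygyOf A n Y.1 X.1 ∧
      ((syzygyEnd A) ^ n) (Finsupp.single (Quotient.mk (indecSetoid A) X) 1) =
        Finsupp.single (Quotient.mk (indecSetoid A) Y) 1 := by
  induction n with
  | zero => exact ⟨X, ⟨LinearEquiv.refl A _⟩, rfl⟩
  | succ n ih =>
    obtain ⟨Y, hY, hcls⟩ := ih
    have := Y.2.1
    have := Y.2.2.1
    obtain ⟨N, hN, hfin, huni⟩ := hA.exists_uniserial_syzygy (hA.2 _ Y.2.1 Y.2.2)
    have hN' : IsNthSyzygyOf A (n + 1) N X.1 := ⟨Y.1, hY, hN⟩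
    have := nontrivial_of_isNthSyzygyOf hpd hN'
    refine ⟨⟨N, hfin, huni.indecomposable⟩, hN', ?_⟩
    rw [add_comm, syzygyEnd_pow_add_apply, hcls, pow_one]
    exact syzygyEnd_single (Y := ⟨N, hfin, huni.indecomposable⟩) huni hN

end InfiniteProjectiveDimension


/-- Let `Λ` be a cyclic Nakayama algebra and `S` a simple module of
infinite projective dimension.  Then `Ω^{φdim Λ}(S)` is periodic; more precisely there
is a periodic module `M` with `Ω^{φdim Λ}(S) ≅ Ω(M)`. -/
theorem nth_syzygy_of_infinite_pdim_simple_is_periodic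
    (A : Type) [Ring A] (hA : IsCyclicNakayama A)
    (S : ModuleCat.{0} A) (hS : IsSimpleModule A ↥S) (hpd : projDim A S = ⊤)
    (t : ℕ) (ht : phiDim A = (t : ℕ∞))
    (N : ModuleCat.{0} A) (hN : IsNthSyzygyOf A t N S) :
    IsPeriodicModule A N ∧
      ∃ M : ModuleCat.{0} A, Module.Finite A ↥M ∧ IsPeriodicModule A M ∧
        IsSyzygyOf A N M := by
  have hNak : IsNakayamaRing A := hA.1.1
  have := hNak.finite_indecIso
  have hSuni : IsUniserialModule A S := fun K K' =>
    (eq_bot_or_eq_top K).elim (fun h => .inl (h ▸ bot_le)) fun h => .inr (h ▸ le_top)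
  have hSnt : Nontrivial S := IsSimpleModule.nontrivial A S
  let X : FGIndec A := ⟨S, inferInstance, hSuni.indecomposable⟩
  choose Y hY hcls using hNak.exists_indecomposable_nthSyzygy X hpd
  obtain ⟨a, b, hab, heq⟩ : ∃ a b, a < b ∧
      Quotient.mk (indecSetoid A) (Y a) = Quotient.mk (indecSetoid A) (Y b) := by
    obtain ⟨a, b, hne, heq⟩ :=
      Finite.exists_ne_map_eq_of_infinite fun n => Quotient.mk (indecSetoid A) (Y n)
    rcases hne.lt_or_gt with h | h
    · exact ⟨a, b, h, heq⟩
    · exact ⟨b, a, h, heq.symm⟩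
  obtain ⟨p, rfl⟩ := Nat.exists_eq_add_of_lt hab
  have hiso : Nonempty ((Y t).1 ≃ₗ[A] (Y (t + (p + 1))).1) := by
    have hpow : ((syzygyEnd A) ^ t) (Finsupp.single (Quotient.mk (indecSetoid A) X) 1) =
        ((syzygyEnd A) ^ t)
          (((syzygyEnd A) ^ (p + 1)) (Finsupp.single (Quotient.mk (indecSetoid A) X) 1)) := by
      apply syzygyEnd_pow_injective ht a
      rw [← syzygyEnd_pow_add_apply, syzygyEnd_pow_add_apply t a, hcls a, heq, ← hcls,
        ← syzygyEnd_pow_add_apply]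
      congr 2
      omega
    rw [← syzygyEnd_pow_add_apply, hcls, hcls] at hpow
    exact Quotient.exact (s := indecSetoid A) (Finsupp.single_left_injective one_ne_zero hpow)
  obtain ⟨e⟩ := hiso
  obtain ⟨i⟩ := hN.unique (hY t)
  obtain ⟨K, hK, hNK⟩ := ((hY (t + (p + 1))).congr_left (i.trans e)).exists_intermediate
  obtain ⟨k⟩ := hK.unique hN
  have hper : IsNthSyzygyOf A (p + 1) N N := hNK.congr_right k
  refine ⟨⟨p + 1, Nat.le_add_left 1 p, hper⟩, ?_⟩
  obtain ⟨M, hM, hNM⟩ := hper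
  obtain ⟨m⟩ := (hM.trans hN).unique (hY (t + p))
  have := (Y (t + p)).2.1
  exact ⟨M, Module.Finite.equiv m.symm,
    ⟨1 + p, Nat.le_add_right 1 p, hM.trans hNM.isNthSyzygyOf_one⟩, hNM⟩

end
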